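/- Let R be a Dedekind domain with fraction field K, let Ω be an algebraic closure of K, and let φ(x) = x^d + A·x^s + B ∈ R[x] be a trinomial with d > s ≥ 1 satisfying: (1) every critical point of φ (every root of φ′ in Ω) lies in the image of R in Ω; (2) φ^n is irreducible over K for a fixed n ≥ 2; (3) d·s·(d−s) ≠ 0 in R; (4) gcd(d, s) = 1. Let α ∈ Ω be a root of φ^{n−1}, and let γ ∈ R be a critical point of φ that is a simple root of φ′ (multiplicity one). Suppose there exists a nonzero prime ideal 𝔭_n ⊂ R such that: (a) the 𝔭_n-adic valuation of φ^n(γ) is odd, i.e. there is an odd k ≥ 1 with φ^n(γ) ∈ 𝔭_n^k and φ^n(γ) ∉ 𝔭_n^{k+1}; (b) d·A·φ^n(0) ∉ 𝔭_n and φ^n(δ) ∉ 𝔭_n for every critical point δ of φ with δ ≠ γ. Then the Galois group of the splitting field of φ(x) − α over K(α) contains an element that acts as a transposition on the roots of φ(x) − α in Ω: it swaps two distinct roots and fixes all the other roots. -/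

import Mathlib

open Polynomial

/-- The `n`-fold iterate `φ^n` of a polynomial under composition (`φ^0 = x`). -/
noncomputable def polyIter {R : Type*} [CommRing R] (φ : Polynomial R) : ℕ → Polynomial R
  | 0 => Polynomial.X
  | n + 1 => φ.comp (polyIter φ n)



open scoped Pointwise in
theorem aux_ram {A B G : Type*} [CommRing A] [CommRing B] [Algebra A B] [Group G]
    [MulSemiringAction G B] [IsGaloisGroup G A B] [Finite G]
    [IsDomain A] [IsDomain B] [Module.Finite A B] [Module.Flat A B]
    (p : Ideal A) (P : Ideal B) [P.LiesOver p] [p.IsPrime] [P.IsPrime]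
    (h : ∀ σ : G, (∀ x : B, σ • x - x ∈ P) → σ = 1) :
    P.ramificationIdx A ≤ 1 := by
  have hcard : Nat.card (MulAction.stabilizer G P) ≤ P.inertiaDeg A := by
    let := Localization.AtPrime.algebraOfLiesOver p P
    have heq : (algebraMap (B ⧸ P) P.ResidueField).comp (algebraMap (A ⧸ p) (B ⧸ P)) =
        (algebraMap p.ResidueField P.ResidueField).comp (algebraMap (A ⧸ p) p.ResidueField) := by
      ext
      simp [← IsScalarTower.algebraMap_apply]
    let := ((algebraMap (B ⧸ P) P.ResidueField).comp (algebraMap (A ⧸ p) (B ⧸ P))).toAlgebra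
    have : IsScalarTower (A ⧸ p) (B ⧸ P) P.ResidueField := .of_algebraMap_eq' rfl
    have : IsScalarTower (A ⧸ p) p.ResidueField P.ResidueField := .of_algebraMap_eq' heq
    have : Module.Finite p.ResidueField P.ResidueField := inferInstance
    have hinj : Function.Injective
        (IsFractionRing.stabilizerHom G p P p.ResidueField P.ResidueField) := by
      rw [← MonoidHom.ker_eq_bot_iff, IsFractionRing.ker_stabilizerHom, eq_bot_iff]
      intro σ hσ
      exact Subtype.ext (h σ hσ)
    rw [Ideal.inertiaDeg_eq p P]
    refine (Nat.card_le_card_of_injective _ hinj).trans ?_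
    have := AlgEquiv.card_le (F := p.ResidueField) (K := P.ResidueField)
    simpa [Nat.card_eq_fintype_card] using this
  have h1 := Ideal.ncard_primesOver_mul_ramificationIdxIn_mul_inertiaDegIn p B G
  rw [Ideal.inertiaDegIn_eq_inertiaDeg p P G, Ideal.ramificationIdxIn_eq_ramificationIdx p P G] at h1
  have h2 : (p.primesOver B).ncard * Nat.card (MulAction.stabilizer G P) = Nat.card G := by
    rw [← Algebra.IsInvariant.orbit_eq_primesOver A B G p P]
    simpa using Nat.card_congr (MulAction.orbitProdStabilizerEquivGroup G P)
  have h3 : (p.primesOver B).ncard ≠ 0 := by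
    intro h0
    rw [h0, zero_mul] at h2
    exact Nat.card_pos.ne h2
  rw [← h2] at h1
  have h4 := Nat.eq_of_mul_eq_mul_left (Nat.pos_of_ne_zero h3) h1
  have h5 : 0 < P.inertiaDeg A := by
    rcases Nat.eq_zero_or_pos (P.inertiaDeg A) with h0 | h0
    · rw [h0, mul_zero] at h4
      exact absurd h4 Nat.card_pos.ne
    · exact h0
  by_contra hlt
  push Not at hlt
  nlinarith

theorem aux_two_roots {B : Type*} [CommRing B] [IsDomain B] (f : B[X]) {b b' : B} (hne : b ≠ b')
    (h : f.eval b = 0) (h' : f.eval b' = 0) : ∃ g : B[X], f = (X - C b) * ((X - C b') * g) := by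
  obtain ⟨f1, rfl⟩ := dvd_iff_isRoot.mpr h
  have : f1.eval b' = 0 := by
    simpa [sub_ne_zero.mpr hne.symm] using h'
  obtain ⟨g, rfl⟩ := dvd_iff_isRoot.mpr this
  exact ⟨g, rfl⟩

theorem aux_taylor {A : Type*} [CommRing A] (f : A[X]) (c : A) (h : (derivative f).eval c = 0) :
    ∃ g : A[X], f = C (f.eval c) + (X - C c) ^ 2 * g ∧
      (derivative (derivative f)).eval c = 2 * g.eval c := by
  obtain ⟨f1, hf1⟩ := X_sub_C_dvd_sub_C_eval (a := c) (p := f)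
  have hf : f = C (f.eval c) + (X - C c) * f1 := by rw [← hf1]; ring
  have h1 : f1.eval c = 0 := by
    rw [hf] at h
    simpa using h
  obtain ⟨g, rfl⟩ := dvd_iff_isRoot.mpr h1
  refine ⟨g, by rw [← mul_assoc, ← sq] at hf; exact hf, ?_⟩
  rw [hf]
  simp
  ring

theorem aux_core {A B G : Type*} [CommRing A] [CommRing B] [Algebra A B] [Group G]
    [MulSemiringAction G B] [IsGaloisGroup G A B] [Finite G]
    [IsDedekindDomain A] [IsDedekindDomain B] [Module.Finite A B] [Module.IsTorsionFree A B]
    (f : A[X]) (hsplit : ∃ ms : Multiset B, f.map (algebraMap A B) = (ms.map (fun r => X - C r)).prod)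
    (hfaith : ∀ σ : G, (∀ b : B, aeval b f = 0 → σ • b = b) → σ = 1)
    (q : Ideal A) [hq : q.IsPrime] (hq0 : q ≠ ⊥) (c : A)
    (hc1 : (derivative f).eval c = 0) (hc2 : (derivative (derivative f)).eval c ∉ q)
    (k : ℕ) (hk : Odd k) (hk1 : f.eval c ∈ q ^ k) (hk2 : f.eval c ∉ q ^ (k + 1))
    (hroot : ∀ Q : Ideal B, Q.IsPrime → Q.LiesOver q → ∀ b : B, aeval b f = 0 →
      aeval b (derivative f) ∈ Q → b - algebraMap A B c ∈ Q) :
    ∃ (σ : G) (b₁ b₂ : B), b₁ ≠ b₂ ∧ aeval b₁ f = 0 ∧ aeval b₂ f = 0 ∧ σ • b₁ = b₂ ∧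
      σ • b₂ = b₁ ∧ ∀ b : B, aeval b f = 0 → b ≠ b₁ → b ≠ b₂ → σ • b = b := by
  classical
  obtain ⟨⟨Q, hQp, hQo⟩⟩ := (inferInstance : Nonempty (Ideal.primesOver q B))
  have hQ0 : Q ≠ ⊥ := Ideal.ne_bot_of_liesOver_of_ne_bot hq0 Q
  set a : B := algebraMap A B c with ha
  set F : B[X] := f.map (algebraMap A B) with hF
  have hev : ∀ b : B, aeval b f = F.eval b := fun b => by rw [hF, eval_map_algebraMap]
  have hevd : ∀ b : B, aeval b (derivative f) = (derivative F).eval b := fun b => by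
    rw [hF, derivative_map, eval_map_algebraMap]
  have hcong : ∀ (p : B[X]) (x y : B), x - y ∈ Q → p.eval x - p.eval y ∈ Q := fun p x y h =>
    Ideal.mem_of_dvd Q (sub_dvd_eval_sub x y p) h
  have hmemQ : ∀ x : A, algebraMap A B x ∈ Q ↔ x ∈ q := fun x => by
    rw [Ideal.over_def Q q]; rfl
  -- two congruent roots
  have key1 : ∀ b b' : B, b ≠ b' → aeval b f = 0 → aeval b' f = 0 → b' - b ∈ Q → b - a ∈ Q := by
    intro b b' hne hb hb' hbb
    apply hroot Q hQp hQo b hb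
    rw [hev] at hb hb'
    obtain ⟨g, hg⟩ := aux_two_roots F hne hb hb'
    rw [hevd, hg]
    simp only [derivative_mul, derivative_sub, derivative_X, derivative_C, eval_add, eval_mul,
      eval_sub, eval_X, eval_C, sub_self, zero_mul, add_zero, sub_zero, eval_one, one_mul]
    exact Ideal.mul_mem_right _ _ (by rw [← neg_sub]; exact neg_mem hbb)
  -- three roots
  have hd2 : (derivative (derivative F)).eval a ∉ Q := by
    rw [hF, derivative_map, derivative_map, ha, eval_map_algebraMap, aeval_algebraMap_apply,
      hmemQ]
    simpa using hc2
  have key2 : ∀ b b' b3 : B, b ≠ b' → b ≠ b3 → b' ≠ b3 → aeval b f = 0 → aeval b' f = 0 →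
      aeval b3 f = 0 → b - a ∈ Q → b' - a ∈ Q → b3 - a ∈ Q → False := by
    intro b b' b3 h1 h2 h3 hb hb' hb3 hba hba' hba3
    rw [hev] at hb hb' hb3
    obtain ⟨g, hg⟩ := aux_two_roots F h1 hb hb'
    have : g.eval b3 = 0 := by
      rw [hg] at hb3
      simpa [sub_ne_zero.mpr h2.symm, sub_ne_zero.mpr h3.symm] using hb3
    obtain ⟨g, rfl⟩ := dvd_iff_isRoot.mpr this
    apply hd2
    rw [hg]
    simp only [derivative_mul, derivative_sub, derivative_X, derivative_C, eval_add, eval_mul,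
      eval_sub, eval_X, eval_C, sub_self, zero_mul, add_zero, sub_zero, eval_one, one_mul,
      derivative_add, derivative_one, zero_add]
    rw [← Ideal.Quotient.eq_zero_iff_mem]
    have e1 : Ideal.Quotient.mk Q b = Ideal.Quotient.mk Q a := Ideal.Quotient.eq.mpr hba
    have e2 : Ideal.Quotient.mk Q b' = Ideal.Quotient.mk Q a := Ideal.Quotient.eq.mpr hba'
    have e3 : Ideal.Quotient.mk Q b3 = Ideal.Quotient.mk Q a := Ideal.Quotient.eq.mpr hba3
    simp [e1, e2, e3]
  -- nontrivial inertia
  have hI : ∃ σ : G, (∀ x : B, σ • x - x ∈ Q) ∧ σ ≠ 1 := by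
    by_contra hcon
    push Not at hcon
    have hram := aux_ram (G := G) q Q hcon
    have hfc0 : f.eval c ≠ 0 := fun h0 => hk2 (by rw [h0]; exact zero_mem _)
    have hk0 : k ≠ 0 := by rintro rfl; simp at hk
    -- a root congruent to `a`
    have hFa : F.eval a = algebraMap A B (f.eval c) := by
      rw [← hev, ha, aeval_algebraMap_apply]; simp
    have hFaQ : F.eval a ∈ Q := by
      rw [hFa, hmemQ]; exact Ideal.pow_le_self hk0 hk1
    obtain ⟨b, hb, hbQ⟩ : ∃ b : B, F.eval b = 0 ∧ b - a ∈ Q := by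
      obtain ⟨ms, hprod⟩ := hsplit
      have hev1 : ∀ y : B, F.eval y = (ms.map (fun r => y - r)).prod := fun y => by
        rw [hprod, eval_multiset_prod, Multiset.map_map]; simp
      rw [hev1] at hFaQ
      obtain ⟨y, hy, hxQ⟩ := (hQp.multiset_prod_mem_iff_exists_mem _).mp hFaQ
      obtain ⟨x, hx, rfl⟩ := Multiset.mem_map.mp hy
      refine ⟨x, ?_, ?_⟩
      · rw [hev1, Multiset.prod_eq_zero_iff]
        exact Multiset.mem_map.mpr ⟨x, hx, sub_self x⟩
      rw [← neg_sub]; exact neg_mem (by simpa using hxQ)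
    obtain ⟨g, hg, hg2⟩ := aux_taylor f c hc1
    have hgb : (g.map (algebraMap A B)).eval b ∉ Q := by
      intro hmem
      have h1 := hcong (g.map (algebraMap A B)) b a hbQ
      have h2 : (g.map (algebraMap A B)).eval a ∈ Q := by
        simpa using Q.sub_mem hmem h1
      rw [ha, eval_map_algebraMap, aeval_algebraMap_apply, hmemQ] at h2
      apply hc2
      rw [hg2]
      exact Ideal.mul_mem_left _ _ (by simpa using h2)
    have heq : algebraMap A B (f.eval c) = -((b - a) ^ 2 * (g.map (algebraMap A B)).eval b) := by
      have : F = C (algebraMap A B (f.eval c)) + (X - C a) ^ 2 * g.map (algebraMap A B) := by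
        rw [hF]; conv_lhs => rw [hg]
        simp [ha]
      rw [this] at hb
      simp only [eval_add, eval_C, eval_mul, eval_pow, eval_sub, eval_X] at hb
      linear_combination hb
    have hqP : Prime q := Ideal.prime_of_isPrime hq0 hq
    have hQP : Prime Q := Ideal.prime_of_isPrime hQ0 hQp
    have hm := Ideal.IsDedekindDomain.emultiplicity_map_eq_ramificationIdx'_mul
      (I := Ideal.span {f.eval c}) (v := q) (w := Q)
      (by simpa using hfc0) hqP.irreducible hQP.irreducible hQ0
    have hmq : emultiplicity q (Ideal.span {f.eval c}) = k := by
      rw [emultiplicity_eq_coe]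
      simp only [Ideal.dvd_span_singleton]
      exact ⟨hk1, hk2⟩
    have hgz : emultiplicity Q (Ideal.span {(g.map (algebraMap A B)).eval b}) = 0 :=
      emultiplicity_eq_zero.mpr (by rwa [Ideal.dvd_span_singleton])
    rw [Ideal.map_span, Set.image_singleton, heq, Ideal.span_singleton_neg,
      ← Ideal.span_singleton_mul_span_singleton, ← Ideal.span_singleton_pow,
      emultiplicity_mul hQP, emultiplicity_pow hQP, hmq,
      hgz, add_zero,
      Ideal.ramificationIdx'_eq_ramificationIdx q Q hq0] at hm
    have hba0 : b - a ≠ 0 := by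
      intro h0
      rw [h0] at heq
      apply hfc0
      apply FaithfulSMul.algebraMap_injective A B
      simpa using heq
    have hfin : FiniteMultiplicity Q (Ideal.span {b - a}) :=
      FiniteMultiplicity.of_prime_left hQP (by simpa using hba0)
    rw [hfin.emultiplicity_eq_multiplicity] at hm
    have hm' : 2 * multiplicity Q (Ideal.span {b - a}) = Q.ramificationIdx A * k := by
      exact_mod_cast hm
    have hpos : 1 ≤ multiplicity Q (Ideal.span {b - a}) := by
      rw [Nat.one_le_iff_ne_zero, Ne, multiplicity_eq_zero, not_not, Ideal.dvd_span_singleton]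
      exact hbQ
    obtain ⟨m, rfl⟩ := hk
    interval_cases Q.ramificationIdx A <;> omega
  obtain ⟨σ, hσ, hσ1⟩ := hI
  have hσr : ∀ b : B, aeval b f = 0 → aeval (σ • b) f = 0 := by
    intro b hb
    have h2 := aeval_algHom_apply (MulSemiringAction.toAlgHom A B σ) b f
    rw [hb, map_zero] at h2
    exact h2
  have hex : ∃ b : B, aeval b f = 0 ∧ σ • b ≠ b := by
    by_contra hcon
    push Not at hcon
    exact hσ1 (hfaith σ hcon)
  obtain ⟨b, hb, hσb⟩ := hex
  have hmove : ∀ b : B, aeval b f = 0 → σ • b ≠ b → b - a ∈ Q := fun b hb h =>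
    key1 b (σ • b) h.symm hb (hσr b hb) (hσ b)
  have hba := hmove b hb hσb
  have hσba : σ • b - a ∈ Q := by
    have := Q.add_mem (hσ b) hba
    simpa using this
  have h2 : σ • σ • b ≠ σ • b := fun h => hσb (smul_left_cancel σ h)
  refine ⟨σ, b, σ • b, hσb.symm, hb, hσr b hb, rfl, ?_, ?_⟩
  · by_contra h3
    refine key2 b (σ • b) (σ • σ • b) hσb.symm (Ne.symm h3) h2.symm hb (hσr _ hb)
      (hσr _ (hσr _ hb)) hba hσba ?_
    have := Q.add_mem (hσ (σ • b)) hσba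
    simpa using this
  · intro x hx hx1 hx2
    by_contra h3
    exact key2 b (σ • b) x hσb.symm hx1.symm hx2.symm hb (hσr _ hb) hx hba hσba (hmove x hx h3)

theorem aux_lift {A Ω : Type*} [CommRing A] [Field Ω] (i : A →+* Ω)
    (hi : Function.Injective i) (D : A[X]) (hs : (D.map i).Splits)
    (hr : ∀ x : Ω, (D.map i).eval x = 0 → ∃ r : A, i r = x) (hD : D ≠ 0) :
    ∃ ms : Multiset A, D = C D.leadingCoeff * (ms.map (fun r => X - C r)).prod := by
  classical
  have hD' : D.map i ≠ 0 := (Polynomial.map_ne_zero_iff hi).mpr hD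
  have hr' : ∀ x ∈ (D.map i).roots, ∃ r : A, i r = x := fun x hx => hr x (mem_roots'.mp hx).2
  obtain ⟨ms, hms⟩ : ∃ ms : Multiset A, ms.map i = (D.map i).roots := by
    choose! g hg using hr'
    refine ⟨(D.map i).roots.map g, ?_⟩
    rw [Multiset.map_map]
    conv_rhs => rw [← Multiset.map_id (D.map i).roots]
    exact Multiset.map_congr rfl hg
  refine ⟨ms, ?_⟩
  apply Polynomial.map_injective i hi
  conv_lhs => rw [hs.eq_prod_roots]
  rw [← hms, leadingCoeff_map_of_injective hi, Polynomial.map_mul, map_C,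
    Polynomial.map_multiset_prod, Multiset.map_map, Multiset.map_map]
  congr 3
  ext x : 1
  simp

theorem aux_field0 {S L Ω M : Type*} [CommRing S] [IsDedekindDomain S] [Field L] [Algebra S L]
    [IsFractionRing S L] [Field Ω] [Algebra L Ω] [Normal L Ω]
    [Field M] [Algebra L M] [Algebra S M] [IsScalarTower S L M] [Algebra M Ω] [IsScalarTower L M Ω]
    (f : S[X]) (hf : f.Monic) (hsep : (f.map (algebraMap S L)).Separable)
    
    [hFM : (f.map (algebraMap S L)).IsSplittingField L M]
    (hMΩ : ∀ b : Ω, aeval b (f.map (algebraMap S L)) = 0 → ∃ x : M, algebraMap M Ω x = b)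
    (q : Ideal S) [hq : q.IsPrime] (hq0 : q ≠ ⊥) (c l : S) (hl : l ∉ q) (ms : Multiset S)
    (hd : derivative f = C l * (ms.map (fun r => X - C r)).prod)
    (hcms : ∃ ms', ms = c ::ₘ ms' ∧ c ∉ ms')
    (hms : ∀ r ∈ ms, r ≠ c → f.eval r ∉ q)
    (k : ℕ) (hk : Odd k) (hk1 : f.eval c ∈ q ^ k) (hk2 : f.eval c ∉ q ^ (k + 1)) :
    ∃ (σ : Ω ≃ₐ[L] Ω) (b₁ b₂ : Ω), b₁ ≠ b₂ ∧ aeval b₁ (f.map (algebraMap S L)) = 0 ∧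
      aeval b₂ (f.map (algebraMap S L)) = 0 ∧ σ b₁ = b₂ ∧
      σ b₂ = b₁ ∧ ∀ b : Ω, aeval b (f.map (algebraMap S L)) = 0 → b ≠ b₁ → b ≠ b₂ → σ b = b := by
  classical
  set F := f.map (algebraMap S L) with hF
  have hFm : F.Monic := hf.map _
  have hk0 : k ≠ 0 := by rintro rfl; simp at hk
  have hfcq : f.eval c ∈ q := Ideal.pow_le_self hk0 hk1
  have : IsGalois L M := IsGalois.of_separable_splitting_field hsep
  have : FiniteDimensional L M := IsSplittingField.finiteDimensional M F
  let T := integralClosure S M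
  have : IsDedekindDomain T := integralClosure.isDedekindDomain S L M
  have : IsFractionRing T M := integralClosure.isFractionRing_of_finite_extension L M
  have : Module.Finite S T := IsIntegralClosure.finite S L M T
  have : Module.IsTorsionFree S M := Module.IsTorsionFree.trans_faithfulSMul S L M
  have : Module.IsTorsionFree S T := inferInstance
  have : IsGaloisGroup Gal(M/L) S T := IsGaloisGroup.of_isFractionRing Gal(M/L) S T L M
  have hTM : Function.Injective (algebraMap T M) := Subtype.val_injective
  have hmapT : ∀ t : T, aeval t f = 0 ↔ aeval (t : M) F = 0 := by
    intro t
    rw [hF, aeval_map_algebraMap, ← map_eq_zero_iff _ hTM, ← aeval_algebraMap_apply]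
    rfl
  have hint : ∀ x : M, aeval x F = 0 → ∃ t : T, (t : M) = x := by
    intro x hx
    refine ⟨⟨x, f, hf, ?_⟩, rfl⟩
    rw [hF, aeval_map_algebraMap] at hx
    exact hx
  have hM : ∀ b : Ω, aeval b F = 0 → ∃ t : T, algebraMap M Ω (t : M) = b := by
    intro b hb
    obtain ⟨x, rfl⟩ := hMΩ b hb
    obtain ⟨t, ht⟩ := hint x (by
      apply (algebraMap M Ω).injective
      rw [← aeval_algebraMap_apply, map_zero]
      exact hb)
    exact ⟨t, by rw [ht]⟩
  have hΩ : ∀ t : T, aeval t f = 0 ↔ aeval (algebraMap M Ω (t : M)) F = 0 := by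
    intro t
    rw [hmapT, ← map_eq_zero_iff _ (algebraMap M Ω).injective, ← aeval_algebraMap_apply]
  have hsplitT : ∃ ms : Multiset T, f.map (algebraMap S T) = (ms.map (fun r => X - C r)).prod := by
    have hm : (f.map (algebraMap S T)).Monic := hf.map _
    have e : (f.map (algebraMap S T)).map (algebraMap T M) = F.map (algebraMap L M) := by
      rw [hF, Polynomial.map_map, Polynomial.map_map, ← IsScalarTower.algebraMap_eq,
        ← IsScalarTower.algebraMap_eq]
    obtain ⟨ms, h⟩ := aux_lift (algebraMap T M) hTM (f.map (algebraMap S T))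
      (by rw [e]; exact IsSplittingField.splits M F)
      (fun x hx => by
        rw [e, eval_map_algebraMap] at hx
        exact hint x hx) hm.ne_zero
    exact ⟨ms, by rw [hm.leadingCoeff, C_1, one_mul] at h; exact h⟩
  have hfaith : ∀ σ : Gal(M/L), (∀ b : T, aeval b f = 0 → σ • b = b) → σ = 1 := by
    intro σ h
    have hE : F.rootSet M ⊆ (AlgHom.equalizer (σ : M →ₐ[L] M) (AlgHom.id L M) : Set M) := by
      intro x hx
      rw [mem_rootSet] at hx
      obtain ⟨t, rfl⟩ := hint x hx.2
      have := congrArg (Subtype.val) (h t ((hmapT t).mpr hx.2))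
      exact this
    have h2 : (⊤ : Subalgebra L M) ≤ AlgHom.equalizer (σ : M →ₐ[L] M) (AlgHom.id L M) := by
      rw [← IsSplittingField.adjoin_rootSet M F]
      exact Algebra.adjoin_le hE
    ext x
    exact h2 (Algebra.mem_top (x := x))
  obtain ⟨ms', hms1, hms2⟩ := hcms
  have hcr : ∀ r ∈ ms', c - r ∉ q := by
    intro r hr hcr
    refine hms r (by rw [hms1]; exact Multiset.mem_cons_of_mem hr) (fun h => hms2 (h ▸ hr)) ?_
    have h1 : f.eval c - f.eval r ∈ q := Ideal.mem_of_dvd q (sub_dvd_eval_sub c r f) hcr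
    have h2 := q.sub_mem hfcq h1
    rwa [sub_sub_cancel] at h2
  have hd1 : derivative f = (X - C c) * (C l * (ms'.map (fun r => X - C r)).prod) := by
    rw [hd, hms1, Multiset.map_cons, Multiset.prod_cons]; ring
  have hc1 : (derivative f).eval c = 0 := by
    rw [hd1]; simp
  have hc2 : (derivative (derivative f)).eval c ∉ q := by
    rw [hd1, derivative_mul]
    simp only [derivative_sub, derivative_X, derivative_C, sub_zero, one_mul, eval_add, eval_mul,
      eval_sub, eval_X, eval_C, sub_self, zero_mul, add_zero]
    intro hmem
    rcases hq.mem_or_mem hmem with h | h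
    · exact hl h
    · rw [eval_multiset_prod, Multiset.map_map] at h
      obtain ⟨y, hy, hyq⟩ := (hq.multiset_prod_mem_iff_exists_mem _).mp h
      obtain ⟨r, hr, rfl⟩ := Multiset.mem_map.mp hy
      exact hcr r hr (by simpa using hyq)
  obtain ⟨σ, b₁, b₂, h1, h2, h3, h4, h5, h6⟩ := aux_core (G := Gal(M/L)) f hsplitT hfaith q hq0 c
    hc1 hc2 k hk hk1 hk2 (by
      intro Q hQ hQo b hb hbd
      rw [hd, map_mul, aeval_C] at hbd
      rcases hQ.mem_or_mem hbd with h | h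
      · exact absurd (by rw [Ideal.over_def Q q]; exact h) hl
      · rw [map_multiset_prod, Multiset.map_map] at h
        obtain ⟨y, hy, hyq⟩ := (hQ.multiset_prod_mem_iff_exists_mem _).mp h
        obtain ⟨r, hr, rfl⟩ := Multiset.mem_map.mp hy
        simp only [Function.comp_apply, map_sub, aeval_X, aeval_C] at hyq
        by_cases hrc : r = c
        · rw [← hrc]; exact hyq
        · exfalso
          apply hms r hr hrc
          have h7 : (f.map (algebraMap S T)).eval b - (f.map (algebraMap S T)).eval
            (algebraMap S T r) ∈ Q := Ideal.mem_of_dvd Q (sub_dvd_eval_sub _ _ _) hyq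
          rw [eval_map_algebraMap, hb, zero_sub, neg_mem_iff, eval_map_algebraMap,
            aeval_algebraMap_apply] at h7
          rw [Ideal.over_def Q q]
          simpa using h7)
  have hσ : ∀ t : T, (σ.liftNormal Ω) (algebraMap M Ω (t : M)) = algebraMap M Ω ((σ • t : T) : M) := fun t =>
    AlgEquiv.liftNormal_commutes σ Ω (t : M)
  refine ⟨σ.liftNormal Ω, algebraMap M Ω (b₁ : M), algebraMap M Ω (b₂ : M), ?_, (hΩ _).mp h2, (hΩ _).mp h3, ?_, ?_, ?_⟩
  · intro h
    exact h1 (Subtype.ext ((algebraMap M Ω).injective h))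
  · rw [hσ, h4]
  · rw [hσ, h5]
  · intro b hb hb1 hb2
    obtain ⟨t, rfl⟩ := hM b hb
    rw [hσ, h6 t ((hΩ t).mpr hb) (fun h => hb1 (by rw [h])) (fun h => hb2 (by rw [h]))]

theorem aux_field {S L Ω : Type*} [CommRing S] [IsDedekindDomain S] [Field L] [Algebra S L]
    [IsFractionRing S L] [Field Ω] [Algebra L Ω] [IsAlgClosed Ω] [Normal L Ω]
    (f : S[X]) (hf : f.Monic) (hsep : (f.map (algebraMap S L)).Separable)
    (q : Ideal S) [hq : q.IsPrime] (hq0 : q ≠ ⊥) (c l : S) (hl : l ∉ q) (ms : Multiset S)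
    (hd : derivative f = C l * (ms.map (fun r => X - C r)).prod)
    (hcms : ∃ ms', ms = c ::ₘ ms' ∧ c ∉ ms')
    (hms : ∀ r ∈ ms, r ≠ c → f.eval r ∉ q)
    (k : ℕ) (hk : Odd k) (hk1 : f.eval c ∈ q ^ k) (hk2 : f.eval c ∉ q ^ (k + 1)) :
    ∃ (σ : Ω ≃ₐ[L] Ω) (b₁ b₂ : Ω), b₁ ≠ b₂ ∧ aeval b₁ (f.map (algebraMap S L)) = 0 ∧
      aeval b₂ (f.map (algebraMap S L)) = 0 ∧ σ b₁ = b₂ ∧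
      σ b₂ = b₁ ∧ ∀ b : Ω, aeval b (f.map (algebraMap S L)) = 0 → b ≠ b₁ → b ≠ b₂ → σ b = b := by
  classical
  set F := f.map (algebraMap S L) with hF
  have hspl : (F.map (algebraMap L Ω)).Splits := IsAlgClosed.splits _
  let M := IntermediateField.adjoin L (F.rootSet Ω)
  have : F.IsSplittingField L M := IntermediateField.adjoin_rootSet_isSplittingField hspl
  let : Algebra S M := ((algebraMap L M).comp (algebraMap S L)).toAlgebra
  have : IsScalarTower S L M := IsScalarTower.of_algebraMap_eq' rfl
  refine aux_field0 (M := M) f hf hsep ?_ q hq0 c l hl ms hd hcms hms k hk hk1 hk2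
  intro b hb
  exact ⟨⟨b, IntermediateField.subset_adjoin L _ (by
      rw [mem_rootSet]; exact ⟨(hf.map _).ne_zero, hb⟩)⟩, rfl⟩

theorem aux_norm {R S : Type*} [CommRing R] [CommRing S] [IsDedekindDomain R] [IsDedekindDomain S]
    [Algebra R S] [Module.Finite R S] [Module.IsTorsionFree R S]
    (p : Ideal R) [hp : p.IsPrime] (hp0 : p ≠ ⊥) (I : Ideal S) (hI : I ≠ ⊥)
    (h : ∀ q : Ideal S, q.IsPrime → q.LiesOver p → Even (multiplicity q I)) :
    Even (multiplicity p (Ideal.relNorm R I)) := by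
  have hpP : Prime p := Ideal.prime_of_isPrime hp0 hp
  have hfin : ∀ J : Ideal S, J ≠ ⊥ → FiniteMultiplicity p (Ideal.relNorm R J) := fun J hJ =>
    FiniteMultiplicity.of_prime_left hpP (by
      rw [Ne, Ideal.zero_eq_bot, Ideal.relNorm_eq_bot_iff]; exact hJ)
  revert hI h
  induction I using UniqueFactorizationMonoid.induction_on_coprime with
  | h0 => intro h; exact absurd rfl h
  | @h1 x hx =>
    intro _ _
    have : x = ⊤ := Ideal.isUnit_iff.mp hx
    rw [this, Ideal.relNorm_top, ← Ideal.one_eq_top, multiplicity_of_one_right hpP.not_isUnit]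
    exact Even.zero
  | @hpr q' i hq' =>
    intro h0 h
    have hq'p : q'.IsPrime := Ideal.isPrime_of_prime hq'
    rw [map_pow]
    by_cases ho : q'.LiesOver p
    · have := h q' hq'p ho
      rw [multiplicity_pow_self hq'.ne_zero hq'.not_isUnit] at this
      obtain ⟨j, rfl⟩ := this
      rw [← two_mul, mul_comm 2 j, pow_mul, sq, multiplicity_mul hpP]
      · exact ⟨_, rfl⟩
      · rw [← map_pow, ← map_mul]
        apply hfin
        rw [← sq]
        exact pow_ne_zero _ (pow_ne_zero _ hq'.ne_zero)
    · rcases Nat.eq_zero_or_pos i with rfl | hi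
      · rw [pow_zero, multiplicity_of_one_right hpP.not_isUnit]
        exact Even.zero
      · rw [multiplicity_eq_zero.mpr]
        · exact Even.zero
        · intro hdvd
          have h1 := hpP.dvd_of_dvd_pow hdvd
          have : (q'.under R).IsPrime := inferInstance
          obtain ⟨s, hs⟩ := Ideal.exists_relNorm_eq_pow_of_isPrime q' (q'.under R)
          rw [hs] at h1
          have h2 := hpP.dvd_of_dvd_pow h1
          rw [Ideal.dvd_iff_le] at h2
          have hne : q'.under R ≠ ⊥ := fun hb =>
            hq'.ne_zero (Ideal.eq_bot_of_comap_eq_bot (R := R) hb)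
          have h3 := (this.isMaximal hne).eq_of_le hp.ne_top h2
          exact ho ⟨h3.symm⟩
  | @hcp x y hxy hx hy =>
    intro h0 h
    have hx0 : x ≠ ⊥ := fun hb => h0 (by rw [hb, Ideal.bot_mul])
    have hy0 : y ≠ ⊥ := fun hb => h0 (by rw [hb, Ideal.mul_bot])
    rw [map_mul, multiplicity_mul hpP (by rw [← map_mul]; exact hfin _ h0)]
    have hz : ∀ q : Ideal S, q.IsPrime → q.LiesOver p →
        Even (multiplicity q x) ∧ Even (multiplicity q y) := by
      intro q hq hqo
      have hqP : Prime q := Ideal.prime_of_isPrime (Ideal.ne_bot_of_liesOver_of_ne_bot hp0 q) hq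
      have h2 := h q hq hqo
      rw [multiplicity_mul hqP (FiniteMultiplicity.of_prime_left hqP h0)] at h2
      by_cases hqx : q ∣ x
      · have : ¬ q ∣ y := fun hqy => hqP.not_isUnit (hxy hqx hqy)
        rw [multiplicity_eq_zero.mpr this] at h2 ⊢
        exact ⟨by simpa using h2, Even.zero⟩
      · rw [multiplicity_eq_zero.mpr hqx] at h2 ⊢
        exact ⟨Even.zero, by simpa using h2⟩
    exact (hx hx0 fun q hq ho => (hz q hq ho).1).add (hy hy0 fun q hq ho => (hz q hq ho).2)

theorem aux_norm' {R S : Type*} [CommRing R] [CommRing S] [IsDedekindDomain R] [IsDedekindDomain S]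
    [Algebra R S] [Module.Finite R S] [Module.IsTorsionFree R S]
    (p : Ideal R) [hp : p.IsPrime] (hp0 : p ≠ ⊥) (x : S) (k : ℕ) (hk : Odd k)
    (hk1 : Algebra.intNorm R S x ∈ p ^ k) (hk2 : Algebra.intNorm R S x ∉ p ^ (k + 1)) :
    ∃ q : Ideal S, q.IsPrime ∧ q.LiesOver p ∧ ∃ j : ℕ, Odd j ∧ x ∈ q ^ j ∧ x ∉ q ^ (j + 1) := by
  have hx0 : x ≠ 0 := by
    rintro rfl
    apply hk2
    rw [Algebra.intNorm_zero]
    exact zero_mem _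
  have hpP : Prime p := Ideal.prime_of_isPrime hp0 hp
  by_contra hcon
  have hev := aux_norm p hp0 (Ideal.span {x}) (by simpa using hx0) (by
    intro q hq hqo
    by_contra hodd
    rw [Nat.not_even_iff_odd] at hodd
    have hqP : Prime q := Ideal.prime_of_isPrime (Ideal.ne_bot_of_liesOver_of_ne_bot hp0 q) hq
    have hfin : FiniteMultiplicity q (Ideal.span {x}) :=
      FiniteMultiplicity.of_prime_left hqP (by simpa using hx0)
    refine hcon ⟨q, hq, hqo, _, hodd, ?_, ?_⟩
    · rw [← Ideal.dvd_span_singleton]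
      exact pow_multiplicity_dvd _ _
    · rw [← Ideal.dvd_span_singleton]
      exact hfin.not_pow_dvd_of_multiplicity_lt (Nat.lt_succ_self _))
  rw [Ideal.relNorm_singleton] at hev
  have : multiplicity p (Ideal.span {Algebra.intNorm R S x}) = k := by
    apply multiplicity_eq_of_emultiplicity_eq_some
    rw [emultiplicity_eq_coe]
    simp only [Ideal.dvd_span_singleton]
    exact ⟨hk1, hk2⟩
  rw [this] at hev
  exact (Nat.not_even_iff_odd.mpr hk) hev

theorem aux_powerBasis_norm {K L : Type*} [Field K] [Field L] [Algebra K L] (pb : PowerBasis K L)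
    (x : K) : Algebra.norm K (algebraMap K L x - pb.gen) = (minpoly K pb.gen).eval x := by
  rw [← charpoly_leftMulMatrix, Matrix.eval_charpoly, Algebra.norm_eq_matrix_det pb.basis, map_sub]
  congr 2
  exact AlgHom.commutes _ _

theorem aux_main {R K L Ω : Type*} [CommRing R] [IsDedekindDomain R] [Field K] [Algebra R K]
    [IsFractionRing R K] [Field L] [Algebra K L] [Algebra R L] [IsScalarTower R K L]
    [Field Ω] [Algebra L Ω] [IsAlgClosed Ω] [Normal L Ω]
    (φ P : R[X]) (hφ : φ.Monic) (hφd : 0 < φ.degree) (hP : P.Monic) (pb : PowerBasis K L)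
    (hmin : minpoly K pb.gen = P.map (algebraMap R K))
    (hsepP : (P.map (algebraMap R K)).Separable)
    (hsep : ((P.comp φ).map (algebraMap R K)).Separable)
    (l : R) (ms : Multiset R) (hd : derivative φ = C l * (ms.map (fun r => X - C r)).prod)
    (γ : R) (hγ : ∃ ms', ms = γ ::ₘ ms' ∧ γ ∉ ms')
    (p : Ideal R) [hp : p.IsPrime] (hp0 : p ≠ ⊥) (hl : l ∉ p)
    (hms : ∀ r ∈ ms, r ≠ γ → (P.comp φ).eval r ∉ p)
    (k : ℕ) (hk : Odd k) (hk1 : (P.comp φ).eval γ ∈ p ^ k) (hk2 : (P.comp φ).eval γ ∉ p ^ (k + 1)) :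
    ∃ (σ : Ω ≃ₐ[L] Ω) (b₁ b₂ : Ω), b₁ ≠ b₂ ∧
      aeval b₁ (φ.map (algebraMap R L) - C pb.gen) = 0 ∧
      aeval b₂ (φ.map (algebraMap R L) - C pb.gen) = 0 ∧ σ b₁ = b₂ ∧
      σ b₂ = b₁ ∧ ∀ b : Ω, aeval b (φ.map (algebraMap R L) - C pb.gen) = 0 →
        b ≠ b₁ → b ≠ b₂ → σ b = b := by
  classical
  have hfd : FiniteDimensional K L := pb.finite
  have hgen : aeval pb.gen P = 0 := by
    have := minpoly.aeval K pb.gen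
    rwa [hmin, aeval_map_algebraMap] at this
  have hLsep : Algebra.IsSeparable K L := by
    have h1 : IsSeparable K pb.gen := by
      rw [IsSeparable, hmin]; exact hsepP
    have h2 := (IntermediateField.isSeparable_adjoin_simple_iff_isSeparable K L).mpr h1
    have h3 : IntermediateField.adjoin K {pb.gen} = ⊤ := by
      rw [← IntermediateField.toSubalgebra_injective.eq_iff,
        IntermediateField.adjoin_simple_toSubalgebra_of_isAlgebraic pb.isIntegral_gen.isAlgebraic,
        pb.adjoin_gen_eq_top, IntermediateField.top_toSubalgebra]
    rw [h3] at h2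
    exact AlgEquiv.Algebra.isSeparable IntermediateField.topEquiv
  let S := integralClosure R L
  have : IsDedekindDomain S := integralClosure.isDedekindDomain R K L
  have : IsFractionRing S L := integralClosure.isFractionRing_of_finite_extension K L
  have : Module.Finite R S := IsIntegralClosure.finite R K L S
  have : Module.IsTorsionFree R L := Module.IsTorsionFree.trans_faithfulSMul R K L
  have : Module.IsTorsionFree R S := inferInstance
  have hRS : Function.Injective (algebraMap R S) := FaithfulSMul.algebraMap_injective R S
  have hSL : Function.Injective (algebraMap S L) := Subtype.val_injective
  have hRK : Function.Injective (algebraMap R K) := FaithfulSMul.algebraMap_injective R K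
  let a : S := ⟨pb.gen, P, hP, hgen⟩
  have haL : algebraMap S L a = pb.gen := rfl
  have haP : aeval a P = 0 := by
    apply hSL
    rw [← aeval_algebraMap_apply, haL, hgen, map_zero]
  let f : S[X] := φ.map (algebraMap R S) - C a
  have hfev : ∀ r : R, f.eval (algebraMap R S r) = algebraMap R S (φ.eval r) - a := by
    intro r
    simp only [f, eval_sub, eval_C, eval_map_algebraMap, aeval_algebraMap_apply]
    simp
  have hfL : f.map (algebraMap S L) = φ.map (algebraMap R L) - C pb.gen := by
    simp only [f, Polynomial.map_sub, map_C, haL, Polynomial.map_map,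
      ← IsScalarTower.algebraMap_eq]
  have hfm : f.Monic := by
    apply (hφ.map _).sub_of_left
    refine lt_of_le_of_lt degree_C_le ?_
    rwa [degree_map_eq_of_injective hRS]
  have hnorm : Algebra.intNorm R S (f.eval (algebraMap R S γ)) = (P.comp φ).eval γ := by
    apply hRK
    rw [Algebra.algebraMap_intNorm (K := K) (L := L), hfev, map_sub, haL,
      ← IsScalarTower.algebraMap_apply, IsScalarTower.algebraMap_apply R K L,
      aux_powerBasis_norm, hmin, eval_map_algebraMap, aeval_algebraMap_apply, eval_comp]
    simp
  obtain ⟨q, hq, hqo, j, hj, hj1, hj2⟩ := aux_norm' p hp0 (f.eval (algebraMap R S γ)) k hk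
    (by rw [hnorm]; exact hk1) (by rw [hnorm]; exact hk2)
  have hmem : ∀ x : R, algebraMap R S x ∈ q ↔ x ∈ p := fun x => by
    rw [Ideal.over_def q p]; rfl
  have hsepf : (f.map (algebraMap S L)).Separable := by
    rw [hfL]
    have h1 := hsep.map (f := algebraMap K L)
    refine h1.of_dvd ?_
    rw [Polynomial.map_map, ← IsScalarTower.algebraMap_eq, Polynomial.map_comp]
    obtain ⟨Q, hQ⟩ : X - C pb.gen ∣ P.map (algebraMap R L) :=
      dvd_iff_isRoot.mpr (by rw [IsRoot, eval_map_algebraMap, hgen])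
    rw [hQ, mul_comp]
    simp
  rw [← hfL]
  obtain ⟨ms', h1, h2⟩ := hγ
  refine aux_field f hfm hsepf q (Ideal.ne_bot_of_liesOver_of_ne_bot hp0 q) (algebraMap R S γ)
    (algebraMap R S l) (by rwa [hmem]) (ms.map (algebraMap R S)) ?_
    ⟨ms'.map (algebraMap R S), by rw [h1, Multiset.map_cons], ?_⟩ ?_ j hj hj1 hj2
  · simp only [f, derivative_sub, derivative_C, sub_zero, derivative_map, hd, Polynomial.map_mul,
      map_C, Polynomial.map_multiset_prod, Multiset.map_map]
    congr 3
    ext x : 1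
    simp
  · rwa [Multiset.mem_map_of_injective hRS]
  · intro r hr hrc hrq
    obtain ⟨r, hr', rfl⟩ := Multiset.mem_map.mp hr
    refine hms r hr' (fun h => hrc (by rw [h])) ?_
    rw [hfev] at hrq
    have h3 : (P.map (algebraMap R S)).eval (algebraMap R S (φ.eval r)) -
      (P.map (algebraMap R S)).eval a ∈ q := Ideal.mem_of_dvd q (sub_dvd_eval_sub _ _ _) hrq
    rw [eval_map_algebraMap, eval_map_algebraMap, haP, sub_zero, aeval_algebraMap_apply, hmem] at h3
    rw [eval_comp]
    simpa using h3

theorem polyIter_succ' {R : Type*} [CommRing R] (φ : R[X]) (n : ℕ) :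
    polyIter φ (n + 1) = (polyIter φ n).comp φ := by
  induction n with
  | zero => simp [polyIter]
  | succ n ih =>
    rw [polyIter, ih, ← comp_assoc, ← ih]
    conv_rhs => rw [polyIter]

theorem polyIter_monic {R : Type*} [CommRing R] [IsDomain R] (φ : R[X]) (hφ : φ.Monic)
    (hd : φ.natDegree ≠ 0) (n : ℕ) :
    (polyIter φ n).Monic ∧ (polyIter φ n).natDegree = φ.natDegree ^ n := by
  induction n with
  | zero => simp [polyIter, monic_X]
  | succ n ih =>
    rw [polyIter, natDegree_comp, ih.2, pow_succ']
    refine ⟨hφ.comp ih.1 ?_, rfl⟩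
    rw [ih.2]
    exact pow_ne_zero _ hd

theorem aux_deriv {R : Type*} [CommRing R] [IsDomain R] (φ : R[X]) (hφ : φ.Monic)
    (hd : φ.natDegree ≠ 0) (hdR : (φ.natDegree : R) ≠ 0) :
    (derivative φ).leadingCoeff = φ.natDegree ∧ derivative φ ≠ 0 := by
  have h1 : (derivative φ).coeff (φ.natDegree - 1) = φ.natDegree := by
    rw [coeff_derivative, Nat.sub_add_cancel (Nat.one_le_iff_ne_zero.mpr hd), hφ.coeff_natDegree,
      one_mul]
    norm_cast
    rw [Nat.sub_add_cancel (Nat.one_le_iff_ne_zero.mpr hd)]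
  have h2 : (derivative φ).natDegree = φ.natDegree - 1 :=
    le_antisymm (natDegree_derivative_le φ) (le_natDegree_of_ne_zero (by rwa [h1]))
  refine ⟨by rw [leadingCoeff, h2, h1], fun h0 => hdR ?_⟩
  rw [← h1, h0, coeff_zero]

theorem aux_irr {K : Type*} [Field K] (P φ : K[X]) (hφ : φ.natDegree ≠ 0)
    (h : Irreducible (P.comp φ)) : Irreducible P := by
  have hu : ∀ Q : K[X], IsUnit (Q.comp φ) → IsUnit Q := by
    intro Q hQ
    have h1 := natDegree_eq_zero_of_isUnit hQ
    rw [natDegree_comp] at h1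
    have h2 : Q.natDegree = 0 := by simpa [hφ] using h1
    rw [eq_C_of_natDegree_eq_zero h2, C_comp] at hQ
    rw [eq_C_of_natDegree_eq_zero h2]
    exact hQ
  refine ⟨fun hP => h.not_isUnit ?_, fun Q Q' hQ => ?_⟩
  · exact hP.map (compRingHom φ)
  · rw [hQ, mul_comp] at h
    exact (h.isUnit_or_isUnit rfl).imp (hu _) (hu _)

/-- For a trinomial `φ = x^d + A x^s + B` over a Dedekind domain `R` with
fraction field `K` and algebraic closure `Ω` of `K`, whose critical points lie in `R`,
with `φ^n` irreducible, a simple critical point `γ` and a prime `𝔭_n` at which `φ^n(γ)` has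
odd valuation and satisfying condition (b), the Galois group of the splitting field of
`φ(x) - α` over `K(α)` contains a transposition on the roots of `φ(x) - α` in `Ω`,
for any root `α` of `φ^{n-1}`. -/
theorem stmt_6
    {R : Type*} [CommRing R] [IsDomain R] [IsDedekindDomain R]
    {K : Type*} [Field K] [Algebra R K] [IsFractionRing R K]
    {Ω : Type*} [Field Ω] [Algebra K Ω] [IsAlgClosure K Ω]
    [Algebra R Ω] [IsScalarTower R K Ω]
    (d s : ℕ) (A B : R) (hsd : s < d) (hs : 1 ≤ s)
    (φ : Polynomial R) (hφ : φ = X ^ d + C A * X ^ s + C B)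
    (hcrit : ∀ x : Ω, Polynomial.aeval x (derivative (φ.map (algebraMap R Ω))) = 0 →
      ∃ r : R, algebraMap R Ω r = x)
    (n : ℕ) (hn : 2 ≤ n)
    (hirr : Irreducible ((polyIter φ n).map (algebraMap R K)))
    (hds : ((d * s * (d - s) : ℕ) : R) ≠ 0)
    (hgcd : Nat.gcd d s = 1)
    (α : Ω) (hα : Polynomial.aeval α ((polyIter φ (n - 1)).map (algebraMap R K)) = 0)
    (γ : R)
    (hγ : Polynomial.rootMultiplicity (algebraMap R Ω γ)
      (derivative (φ.map (algebraMap R Ω))) = 1)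
    (pn : Ideal R) (hpn : pn.IsPrime) (hpn0 : pn ≠ ⊥)
    (hodd : ∃ k : ℕ, Odd k ∧ 1 ≤ k ∧
      (polyIter φ n).eval γ ∈ pn ^ k ∧ (polyIter φ n).eval γ ∉ pn ^ (k + 1))
    (hb1 : (d : R) * A * (polyIter φ n).eval 0 ∉ pn)
    (hb2 : ∀ δ : R,
      Polynomial.aeval (algebraMap R Ω δ) (derivative (φ.map (algebraMap R Ω))) = 0 →
      algebraMap R Ω δ ≠ algebraMap R Ω γ → (polyIter φ n).eval δ ∉ pn) :
    ∃ (σ : Ω ≃ₐ[↥(IntermediateField.adjoin K {α})] Ω) (α₁ α₂ : Ω), α₁ ≠ α₂ ∧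
      Polynomial.eval α₁ (φ.map (algebraMap R Ω)) = α ∧
      Polynomial.eval α₂ (φ.map (algebraMap R Ω)) = α ∧
      σ α₁ = α₂ ∧ σ α₂ = α₁ ∧
      ∀ β : Ω, Polynomial.eval β (φ.map (algebraMap R Ω)) = α → β ≠ α₁ → β ≠ α₂ →
        σ β = β := by
  classical
  obtain ⟨k, hk, -, hk1, hk2⟩ := hodd
  have hΩ : IsAlgClosed Ω := IsAlgClosure.isAlgClosed K
  have hRK : Function.Injective (algebraMap R K) := FaithfulSMul.algebraMap_injective R K
  have hRΩ : Function.Injective (algebraMap R Ω) := by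
    rw [IsScalarTower.algebraMap_eq R K Ω]
    exact (algebraMap K Ω).injective.comp hRK
  have hd0 : d ≠ 0 := by omega
  have hφ1 : φ.Monic := by
    rw [hφ, add_assoc]
    apply monic_X_pow_add
    refine lt_of_le_of_lt (degree_add_le _ _) (max_lt ?_ ?_)
    · exact lt_of_le_of_lt (degree_C_mul_X_pow_le _ _) (by exact_mod_cast hsd)
    · exact lt_of_le_of_lt degree_C_le (by exact_mod_cast Nat.pos_of_ne_zero hd0)
  have hφd : φ.natDegree = d := by
    rw [hφ, add_assoc]
    have h1 : (C A * X ^ s + C B : R[X]).natDegree ≤ s :=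
      natDegree_add_le_of_degree_le (natDegree_C_mul_X_pow_le _ _) (by simp)
    rw [natDegree_add_eq_left_of_natDegree_lt, natDegree_X_pow]
    rw [natDegree_X_pow]
    omega
  have hdR : (d : R) ≠ 0 := by
    intro h0
    apply hds
    push_cast
    rw [h0]; ring
  have hφ0 : φ.natDegree ≠ 0 := by rwa [hφd]
  obtain ⟨hlc, hφ'0⟩ := aux_deriv φ hφ1 hφ0 (by rwa [hφd])
  obtain ⟨ms, hms⟩ := aux_lift (algebraMap R Ω) hRΩ (derivative φ) (IsAlgClosed.splits _)
    (fun x hx => hcrit x (by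
      rw [derivative_map, coe_aeval_eq_eval]; exact hx)) hφ'0
  rw [hlc, hφd] at hms
  have hroots : (derivative φ).roots = ms := by
    rw [hms, roots_C_mul _ hdR, roots_multiset_prod_X_sub_C]
  have hcount : ms.count γ = 1 := by
    rw [← hroots, count_roots, eq_rootMultiplicity_map hRΩ, ← derivative_map]
    exact hγ
  obtain ⟨ms', hms'⟩ := Multiset.exists_cons_of_mem
    (Multiset.count_pos.mp (by rw [hcount]; exact one_pos))
  have hms2 : γ ∉ ms' := by
    rw [hms', Multiset.count_cons_self] at hcount
    exact Multiset.count_eq_zero.mp (by omega)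
  obtain ⟨m, rfl⟩ : ∃ m, n = m + 1 := ⟨n - 1, by omega⟩
  rw [Nat.add_sub_cancel] at hα
  rw [polyIter_succ'] at hirr hk1 hk2
  have hsepgen : ∀ j, Irreducible ((polyIter φ j).map (algebraMap R K)) →
      ((polyIter φ j).map (algebraMap R K)).Separable := by
    intro j hj
    rw [separable_iff_derivative_ne_zero hj, derivative_map, Ne, Polynomial.map_eq_zero_iff hRK]
    obtain ⟨h1, h2⟩ := polyIter_monic φ hφ1 hφ0 j
    refine (aux_deriv _ h1 ?_ ?_).2
    · rw [h2]; exact pow_ne_zero _ hφ0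
    · rw [h2, hφd]; push_cast; exact pow_ne_zero _ hdR
  have hsep := hsepgen (m + 1) (by rw [polyIter_succ']; exact hirr)
  rw [polyIter_succ'] at hsep
  have hirrP : Irreducible ((polyIter φ m).map (algebraMap R K)) := by
    rw [Polynomial.map_comp] at hirr
    refine aux_irr _ _ ?_ hirr
    rwa [natDegree_map_eq_of_injective hRK]
  have hPm := (polyIter_monic φ hφ1 hφ0 m).1
  have hmin := minpoly.eq_of_irreducible_of_monic hirrP hα (hPm.map _)
  have hint : IsIntegral K α := ⟨_, hPm.map _, hα⟩
  let pb := IntermediateField.adjoin.powerBasis hint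
  have hpbg : pb.gen = IntermediateField.AdjoinSimple.gen K α :=
    IntermediateField.adjoin.powerBasis_gen hint
  obtain ⟨σ, b₁, b₂, h1, h2, h3, h4, h5, h6⟩ := aux_main (Ω := Ω) φ (polyIter φ m) hφ1
    (natDegree_pos_iff_degree_pos.mp (Nat.pos_of_ne_zero hφ0)) hPm pb
    (by rw [hpbg, IntermediateField.minpoly_gen, ← hmin]) (hsepgen m hirrP) hsep
    (d : R) ms hms γ ⟨ms', hms', hms2⟩ pn hpn0
    (fun h => hb1 (by
      rw [mul_assoc]
      exact Ideal.mul_mem_right _ _ h))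
    (fun r hr hrγ => by
      rw [← polyIter_succ']
      refine hb2 r ?_ (fun h => hrγ (hRΩ h))
      rw [← hroots] at hr
      rw [derivative_map, coe_aeval_eq_eval, eval_map_algebraMap, aeval_algebraMap_apply,
        coe_aeval_eq_eval, (mem_roots'.mp hr).2, map_zero])
    k hk hk1 hk2
  have hst : (algebraMap (IntermediateField.adjoin K {α}) Ω).comp
      (algebraMap R (IntermediateField.adjoin K {α})) = algebraMap R Ω := by
    rw [IsScalarTower.algebraMap_eq R K (IntermediateField.adjoin K {α}), ← RingHom.comp_assoc,
      ← IsScalarTower.algebraMap_eq, ← IsScalarTower.algebraMap_eq]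
  have hiff : ∀ b : Ω,
      aeval b (φ.map (algebraMap R (IntermediateField.adjoin K {α})) - C pb.gen) = 0 ↔
        Polynomial.eval b (φ.map (algebraMap R Ω)) = α := by
    intro b
    rw [map_sub, aeval_C, hpbg, IntermediateField.AdjoinSimple.algebraMap_gen, sub_eq_zero,
      ← eval_map_algebraMap, Polynomial.map_map, hst]
  exact ⟨σ, b₁, b₂, h1, (hiff _).mp h2, (hiff _).mp h3, h4, h5,
    fun β hβ => h6 β ((hiff β).mpr hβ)⟩
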